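/- Fix integers m ≥ 2, n ≥ 1 and let P_U be the uniform distribution on 𝒳. For every real D with 0 < D ≤ n(m−1)/m, the infimum of I(P_U,Q) over all (P_U,D)-valid mechanisms Q equals n·log( m(1 − D/n) ) + D·log( D/((m−1)(n−D)) ); and for every real D with n(m−1)/m ≤ D ≤ n this infimum equals 0. -/

import Mathlib

open Finset Real

/-- The mutual information `I(P,Q) = Σ_{x,y} P(x) Q(y|x) log(Q(y|x) / Σ_{x'} P(x') Q(y|x'))`
of a mechanism `Q` on `𝒳 = Fin n → Fin m` under a prior `P` (with `0 · log 0 = 0`,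
which holds automatically since `Real.log 0 = 0`). -/
noncomputable def mutualInfo (m n : ℕ) (P : (Fin n → Fin m) → ℝ)
    (Q : (Fin n → Fin m) → (Fin n → Fin m) → ℝ) : ℝ :=
  ∑ x, ∑ y, P x * Q x y * Real.log (Q x y / ∑ x', P x' * Q x' y)

/-- The privacy–distortion function for mutual information under the uniform prior
`P_U(x) = m^{-n}`: the infimum of `I(P_U,Q)` over all `(P_U, D)`-valid mechanisms `Q`. -/
noncomputable def pdMI (m n : ℕ) (D : ℝ) : ℝ :=
  sInf {v : ℝ | ∃ Q : (Fin n → Fin m) → (Fin n → Fin m) → ℝ,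
    (∀ x y, 0 ≤ Q x y) ∧ (∀ x, ∑ y, Q x y = 1) ∧
    (∑ x, ∑ y, ((m : ℝ) ^ n)⁻¹ * Q x y * (hammingDist x y : ℝ)) ≤ D ∧
    v = mutualInfo m n (fun _ => ((m : ℝ) ^ n)⁻¹) Q}

/-- single-letter symmetric channel -/
noncomputable def chW (m : ℕ) (a b : ℝ) (x y : Fin m) : ℝ := if x = y then a else b

/-- product of symmetric channels -/
noncomputable def prodW (m n : ℕ) (a b : ℝ) (x y : Fin n → Fin m) : ℝ :=
  ∏ i, chW m a b (x i) (y i)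

lemma chW_symm (m : ℕ) (a b : ℝ) (x y : Fin m) : chW m a b x y = chW m a b y x := by
  unfold chW; simp only [eq_comm]

lemma prodW_symm (m n : ℕ) (a b : ℝ) (x y : Fin n → Fin m) :
    prodW m n a b x y = prodW m n a b y x := by
  unfold prodW; exact Finset.prod_congr rfl fun i _ => chW_symm _ _ _ _ _

lemma chW_sum (m : ℕ) (a b : ℝ) (h : a + ((m : ℝ) - 1) * b = 1) (x : Fin m) :
    ∑ y, chW m a b x y = 1 := by
  have : ∀ y, chW m a b x y = b + (if x = y then a - b else 0) := by
    intro y; unfold chW; split_ifs <;> ring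
  simp only [this, Finset.sum_add_distrib, Finset.sum_ite_eq]
  simp
  linarith

lemma chW_ne_sum (m : ℕ) (a b : ℝ) (h : a + ((m : ℝ) - 1) * b = 1) (x : Fin m) :
    ∑ y, chW m a b x y * (if x = y then 0 else 1) = ((m : ℝ) - 1) * b := by
  have : ∀ y, chW m a b x y * (if x = y then 0 else 1)
      = chW m a b x y - (if x = y then a else 0) := by
    intro y; unfold chW; split_ifs <;> ring
  simp only [this, Finset.sum_sub_distrib, chW_sum m a b h, Finset.sum_ite_eq]
  simp
  linarith

lemma prodW_sum (m n : ℕ) (a b : ℝ) (h : a + ((m : ℝ) - 1) * b = 1) (x : Fin n → Fin m) :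
    ∑ y, prodW m n a b x y = 1 := by
  unfold prodW
  rw [← Fintype.prod_sum (fun i (j : Fin m) => chW m a b (x i) j)]
  simp [chW_sum m a b h]

lemma prodW_sum_left (m n : ℕ) (a b : ℝ) (h : a + ((m : ℝ) - 1) * b = 1) (y : Fin n → Fin m) :
    ∑ x, prodW m n a b x y = 1 := by
  rw [← prodW_sum m n a b h y]
  exact Finset.sum_congr rfl fun x _ => prodW_symm _ _ _ _ _ _

lemma hamming_cast (m n : ℕ) (x y : Fin n → Fin m) :
    (hammingDist x y : ℝ) = ∑ i, (if x i = y i then (0 : ℝ) else 1) := by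
  unfold hammingDist
  rw [Finset.card_filter]
  push_cast
  refine Finset.sum_congr rfl fun i _ => ?_
  by_cases hh : x i = y i <;> simp [hh]

lemma prodW_dist (m n : ℕ) (a b : ℝ) (h : a + ((m : ℝ) - 1) * b = 1) (x : Fin n → Fin m) :
    ∑ y, prodW m n a b x y * (hammingDist x y : ℝ) = n * (((m : ℝ) - 1) * b) := by
  simp only [hamming_cast, Finset.mul_sum]
  rw [Finset.sum_comm]
  have key : ∀ i, ∑ y : Fin n → Fin m, prodW m n a b x y * (if x i = y i then (0 : ℝ) else 1)
      = ((m : ℝ) - 1) * b := by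
    intro i
    have : ∀ y : Fin n → Fin m, prodW m n a b x y * (if x i = y i then (0 : ℝ) else 1)
        = ∏ j, (chW m a b (x j) (y j) *
          (if j = i then (if x j = y j then (0 : ℝ) else 1) else 1)) := by
      intro y
      rw [Finset.prod_mul_distrib, Finset.prod_ite_eq']
      simp [prodW]
    simp only [this]
    rw [← Fintype.prod_sum (fun j (k : Fin m) => chW m a b (x j) k *
          (if j = i then (if x j = k then (0 : ℝ) else 1) else 1))]
    rw [Finset.prod_eq_single i]
    · simpa using chW_ne_sum m a b h (x i)
    · intro j _ hj
      simp [hj, chW_sum m a b h]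
    · simp
  rw [Finset.sum_congr rfl fun i _ => key i]
  simp

lemma prodW_pos (m n : ℕ) (a b : ℝ) (ha : 0 < a) (hb : 0 < b) (x y : Fin n → Fin m) :
    0 < prodW m n a b x y := by
  unfold prodW chW
  refine Finset.prod_pos fun i _ => ?_
  split_ifs <;> assumption

lemma prodW_log (m n : ℕ) (a b : ℝ) (hm : 2 ≤ m) (ha : 0 < a) (hb : 0 < b)
    (x y : Fin n → Fin m) :
    Real.log ((m : ℝ) ^ n * prodW m n a b x y)
      = n * Real.log (m * a) + (hammingDist x y : ℝ) * Real.log (b / a) := by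
  have hm0 : (m : ℝ) ≠ 0 := by positivity
  rw [Real.log_mul (by positivity) (prodW_pos m n a b ha hb x y).ne', hamming_cast]
  unfold prodW chW
  rw [Real.log_prod (fun i _ => by split_ifs <;> positivity), Finset.sum_mul,
    Real.log_pow, Real.log_mul hm0 ha.ne', Real.log_div hb.ne' ha.ne', mul_add, add_assoc]
  congr 1
  have : (n : ℝ) * Real.log a = ∑ _i : Fin n, Real.log a := by simp
  rw [this, ← Finset.sum_add_distrib]
  refine Finset.sum_congr rfl fun i _ => ?_
  split_ifs <;> ring

lemma term_ineq (N t q w : ℝ) (hN : 0 < N) (ht : 0 ≤ t) (hw : 0 < w) (hq : 0 ≤ q)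
    (htq : 0 < t → 0 < q) :
    t * Real.log (N * w) + (t - q * N * w) ≤ t * Real.log (t / q) := by
  rcases ht.eq_or_lt with h | h
  · subst h
    have : 0 ≤ q * N * w := by positivity
    simp; exact this
  · have hq' := htq h
    have h1 := Real.log_le_sub_one_of_pos (show 0 < q * N * w / t by positivity)
    have h2 : Real.log (q * N * w / t) = Real.log (N * w) - Real.log (t / q) := by
      rw [← Real.log_div (by positivity) (by positivity)]
      congr 1
      field_simp
    rw [h2] at h1
    have h3 := mul_le_mul_of_nonneg_left h1 h.le
    have h4 : t * (q * N * w / t - 1) = q * N * w - t := by field_simp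
    rw [h4] at h3
    linarith

lemma card_inv_sum (m n : ℕ) (hm : 2 ≤ m) (c : ℝ) :
    ∑ _x : Fin n → Fin m, ((m : ℝ) ^ n)⁻¹ * c = c := by
  have hm0 : (m : ℝ) ≠ 0 := by positivity
  simp
  field_simp

lemma sum_lin (m n : ℕ) (hm : 2 ≤ m) (Q : (Fin n → Fin m) → (Fin n → Fin m) → ℝ)
    (h1 : ∀ x, ∑ y, Q x y = 1) (c e : ℝ) :
    ∑ x, ∑ y, ((m : ℝ) ^ n)⁻¹ * Q x y * (c + (hammingDist x y : ℝ) * e)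
      = c + (∑ x, ∑ y, ((m : ℝ) ^ n)⁻¹ * Q x y * (hammingDist x y : ℝ)) * e := by
  simp only [mul_add, Finset.sum_add_distrib, Finset.sum_mul, ← mul_assoc]
  congr 1
  have : ∀ x, ∑ y, ((m : ℝ) ^ n)⁻¹ * Q x y * c = ((m : ℝ) ^ n)⁻¹ * c := by
    intro x
    rw [← Finset.sum_mul, ← Finset.mul_sum, h1]; ring
  simp only [this]
  exact card_inv_sum m n hm c

lemma lower (m n : ℕ) (a b : ℝ) (hm : 2 ≤ m) (h : a + ((m : ℝ) - 1) * b = 1)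
    (ha : 0 < a) (hb : 0 < b) (hba : b ≤ a) (D : ℝ)
    (Q : (Fin n → Fin m) → (Fin n → Fin m) → ℝ)
    (h0 : ∀ x y, 0 ≤ Q x y) (h1 : ∀ x, ∑ y, Q x y = 1)
    (hD : (∑ x, ∑ y, ((m : ℝ) ^ n)⁻¹ * Q x y * (hammingDist x y : ℝ)) ≤ D) :
    n * Real.log (m * a) + D * Real.log (b / a)
      ≤ mutualInfo m n (fun _ => ((m : ℝ) ^ n)⁻¹) Q := by
  have hm0 : (0 : ℝ) < m := by positivity
  have hN : (0 : ℝ) < (m : ℝ) ^ n := by positivity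
  set q : (Fin n → Fin m) → ℝ := fun y => ∑ x', ((m : ℝ) ^ n)⁻¹ * Q x' y with hq
  have hq0 : ∀ y, 0 ≤ q y := fun y =>
    Finset.sum_nonneg fun x _ => mul_nonneg (by positivity) (h0 x y)
  have hqp : ∀ x y, 0 < Q x y → 0 < q y := fun x y hxy =>
    Finset.sum_pos' (fun x _ => mul_nonneg (by positivity) (h0 x y))
      ⟨x, Finset.mem_univ _, by positivity⟩
  have hqs : ∑ y, q y = 1 := by
    simp only [hq]
    rw [Finset.sum_comm]
    simp only [← Finset.mul_sum, h1]
    rw [Finset.mul_sum]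
    exact card_inv_sum m n hm 1
  have hlog : Real.log (b / a) ≤ 0 :=
    Real.log_nonpos (by positivity) ((div_le_one ha).2 hba)
  have step1 : ∑ x, ∑ y, (((m : ℝ) ^ n)⁻¹ * Q x y *
        (n * Real.log (m * a) + (hammingDist x y : ℝ) * Real.log (b / a))
        + (((m : ℝ) ^ n)⁻¹ * Q x y - q y * prodW m n a b x y))
      ≤ mutualInfo m n (fun _ => ((m : ℝ) ^ n)⁻¹) Q := by
    unfold mutualInfo
    refine Finset.sum_le_sum fun x _ => Finset.sum_le_sum fun y _ => ?_
    have := term_ineq ((m : ℝ) ^ n) (Q x y) (q y) (prodW m n a b x y) hN (h0 x y)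
      (prodW_pos m n a b ha hb x y) (hq0 y) (hqp x y)
    rw [prodW_log m n a b hm ha hb] at this
    have := mul_le_mul_of_nonneg_left this (inv_nonneg.2 hN.le)
    rw [mul_assoc _ (Q x y) (Real.log _)]
    refine le_trans (le_of_eq ?_) this
    field_simp
  have e1 : ∑ x, ∑ y, ((m : ℝ) ^ n)⁻¹ * Q x y = 1 := by
    simp only [← Finset.mul_sum, h1]
    rw [Finset.mul_sum]
    exact card_inv_sum m n hm 1
  have e2 : ∑ x, ∑ y, q y * prodW m n a b x y = 1 := by
    rw [Finset.sum_comm]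
    simp only [← Finset.mul_sum, prodW_sum_left m n a b h, mul_one, hqs]
  simp only [Finset.sum_add_distrib, Finset.sum_sub_distrib] at step1
  rw [e1, e2, sum_lin m n hm Q h1] at step1
  have := mul_le_mul_of_nonpos_right hD hlog
  linarith

lemma dist_W (m n : ℕ) (a b : ℝ) (hm : 2 ≤ m) (h : a + ((m : ℝ) - 1) * b = 1) :
    ∑ x, ∑ y, ((m : ℝ) ^ n)⁻¹ * prodW m n a b x y * (hammingDist x y : ℝ)
      = n * (((m : ℝ) - 1) * b) := by
  simp only [mul_assoc, ← Finset.mul_sum]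
  simp only [prodW_dist m n a b h]
  rw [Finset.mul_sum]
  exact card_inv_sum m n hm _

lemma info_W (m n : ℕ) (a b : ℝ) (hm : 2 ≤ m) (h : a + ((m : ℝ) - 1) * b = 1)
    (ha : 0 < a) (hb : 0 < b) :
    mutualInfo m n (fun _ => ((m : ℝ) ^ n)⁻¹) (prodW m n a b)
      = n * Real.log (m * a) + n * (((m : ℝ) - 1) * b) * Real.log (b / a) := by
  rw [← dist_W m n a b hm h, ← sum_lin m n hm _ (prodW_sum m n a b h)]
  unfold mutualInfo
  refine Finset.sum_congr rfl fun x _ => Finset.sum_congr rfl fun y _ => ?_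
  rw [← prodW_log m n a b hm ha hb, ← Finset.mul_sum, prodW_sum_left m n a b h]
  congr 2
  rw [mul_one, div_inv_eq_mul, mul_comm]

lemma pdMI_eq (m n : ℕ) (a b : ℝ) (hm : 2 ≤ m) (h : a + ((m : ℝ) - 1) * b = 1)
    (ha : 0 < a) (hb : 0 < b) (hba : b ≤ a) (D : ℝ) (hD : n * (((m : ℝ) - 1) * b) ≤ D)
    (heq : D * Real.log (b / a) = n * (((m : ℝ) - 1) * b) * Real.log (b / a)) :
    pdMI m n D = n * Real.log (m * a) + D * Real.log (b / a) := by
  unfold pdMI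
  refine IsLeast.csInf_eq ⟨⟨prodW m n a b, fun x y => (prodW_pos m n a b ha hb x y).le,
    prodW_sum m n a b h, ?_, ?_⟩, ?_⟩
  · rw [dist_W m n a b hm h]; exact hD
  · rw [info_W m n a b hm h ha hb, heq]
  · rintro v ⟨Q, h0, h1, hQ, rfl⟩
    exact lower m n a b hm h ha hb hba D Q h0 h1 hQ

/-- under the uniform prior, for `0 < D ≤ n(m-1)/m` the infimum of
`I(P_U,Q)` over `(P_U,D)`-valid mechanisms equals
`n log(m(1-D/n)) + D log(D/((m-1)(n-D)))`, and for `n(m-1)/m ≤ D ≤ n` it equals `0`. -/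
theorem stmt_12 (m n : ℕ) (hm : 2 ≤ m) (hn : 1 ≤ n) :
    (∀ D : ℝ, 0 < D → D ≤ (n : ℝ) * ((m : ℝ) - 1) / m →
      pdMI m n D = (n : ℝ) * Real.log ((m : ℝ) * (1 - D / n)) +
        D * Real.log (D / (((m : ℝ) - 1) * ((n : ℝ) - D)))) ∧
    (∀ D : ℝ, (n : ℝ) * ((m : ℝ) - 1) / m ≤ D → D ≤ (n : ℝ) →
      pdMI m n D = 0) := by
  have hm2 : (2 : ℝ) ≤ m := by exact_mod_cast hm
  have hn1 : (1 : ℝ) ≤ n := by exact_mod_cast hn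
  have hm0 : (0 : ℝ) < m := by linarith
  have hn0 : (0 : ℝ) < n := by linarith
  have hm1 : (0 : ℝ) < (m : ℝ) - 1 := by linarith
  constructor
  · intro D hD0 hD
    rw [le_div_iff₀ hm0] at hD
    have hDn : D < n := by nlinarith
    have hnD : 0 < (n : ℝ) - D := by linarith
    have ha : 0 < 1 - D / n := by
      rw [sub_pos, div_lt_one hn0]; exact hDn
    have hb : 0 < D / (n * ((m : ℝ) - 1)) := by positivity
    have hmul : (n : ℝ) * (((m : ℝ) - 1) * (D / (n * ((m : ℝ) - 1)))) = D := by
      field_simp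
    have e : D / (n * ((m : ℝ) - 1)) / (1 - D / n) = D / (((m : ℝ) - 1) * ((n : ℝ) - D)) := by
      have : 1 - D / n = (n - D) / n := by field_simp
      rw [this]
      field_simp
    rw [← e]
    refine pdMI_eq m n _ _ hm ?_ ha hb ?_ D hmul.le (by rw [hmul])
    · field_simp
      ring
    · have : 1 - D / n = (n - D) / n := by field_simp
      rw [this, div_le_div_iff₀ (by positivity) hn0]
      nlinarith
  · intro D hD _
    have := pdMI_eq m n (1 / m) (1 / m) hm (by field_simp; ring) (by positivity) (by positivity)
      le_rfl D (by refine le_trans (le_of_eq ?_) hD; ring)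
      (by rw [div_self (by positivity)]; simp)
    rw [this, div_self (by positivity)]
    simp [hm0.ne']
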